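/- arXiv:1309.3381 — 2 statements merged into one kernel-verified Lean document; each statement's English description precedes it below -/
import Mathlib

section
/- Let d, d' ∈ ℕ, let F and F' be finite groups, let G = ℤ^d × F and G' = ℤ^{d'} × F', and let S ⊆ G and S' ⊆ G' be finite monoid generating sets with β_{G,S} = β_{G',S'}. Then d = d'. -/
/-- `S` is a monoid generating set of the group `G`: every element of `G` is a
product of finitely many elements of `S`. -/
def IsMonGenSet {G : Type*} [Group G] (S : Set G) : Prop := Submonoid.closure S = ⊤

/-- `S` is symmetric: closed under inverses. -/
def IsSymmSet {G : Type*} [Group G] (S : Set G) : Prop := ∀ s ∈ S, s⁻¹ ∈ S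

/-- The word length of `g` with respect to `S`: the least `n` such that `g` is a
product of `n` elements of `S`. -/
noncomputable def wlen {G : Type*} [Group G] (S : Set G) (g : G) : ℕ :=
  sInf {n | ∃ l : List G, (∀ x ∈ l, x ∈ S) ∧ l.length = n ∧ l.prod = g}

/-- The growth function `β_{G,S}`: the cardinality of the ball of radius `r`. -/
noncomputable def growth {G : Type*} [Group G] (S : Set G) (r : ℕ) : ℕ :=
  Set.ncard {g : G | wlen S g ≤ r}

/-- The spherical growth function `σ_{G,S}`. -/
noncomputable def sph {G : Type*} [Group G] (S : Set G) (r : ℕ) : ℕ :=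
  Set.ncard {g : G | wlen S g = r}

/-- The standard symmetric generating set `E_d ∪ (-E_d)` of `ℤ^d`. -/
def stdSymmSet (d : ℕ) : Set (Multiplicative (Fin d → ℤ)) :=
  {x | ∃ i : Fin d, x = Multiplicative.ofAdd (Pi.single i 1) ∨
       x = Multiplicative.ofAdd (-Pi.single i 1)}

/-- The standard symmetric growth function `β_d` of `ℤ^d`. -/
noncomputable def betaStd (d : ℕ) : ℕ → ℕ := growth (stdSymmSet d)

/-- The standard monoid generating set `E_d ∪ {v_d}` of `ℤ^d`. -/
def stdMonSet (d : ℕ) : Set (Multiplicative (Fin d → ℤ)) :=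
  {x | (∃ i : Fin d, x = Multiplicative.ofAdd (Pi.single i 1)) ∨
       x = Multiplicative.ofAdd (fun _ => (-1 : ℤ))}

/-- The standard monoid growth function `β⁺_d` of `ℤ^d`. -/
noncomputable def betaPlus (d : ℕ) : ℕ → ℕ := growth (stdMonSet d)

/-- The rank of a finitely generated abelian group. -/
noncomputable def rk (G : Type*) [CommGroup G] : ℕ := Module.finrank ℤ (Additive G)

section WordLength

variable {G : Type*} [Group G] {S : Set G}

theorem wlen_le_length {l : List G} (hl : ∀ x ∈ l, x ∈ S) : wlen S l.prod ≤ l.length :=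
  Nat.sInf_le ⟨l, hl, rfl, rfl⟩

theorem IsMonGenSet.exists_list_length_eq_wlen (hS : IsMonGenSet S) (g : G) :
    ∃ l : List G, (∀ x ∈ l, x ∈ S) ∧ l.length = wlen S g ∧ l.prod = g := by
  have hg : g ∈ Submonoid.closure S := by
    unfold IsMonGenSet at hS
    rw [hS]
    trivial
  obtain ⟨l, hl, hp⟩ := Submonoid.exists_list_of_mem_closure hg
  exact Nat.sInf_mem (s := {n | ∃ l : List G, (∀ x ∈ l, x ∈ S) ∧ l.length = n ∧ l.prod = g})
    ⟨l.length, l, hl, rfl, hp⟩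

theorem wlen_one (S : Set G) : wlen S 1 = 0 :=
  Nat.le_zero.1 (wlen_le_length (l := []) (by simp))

theorem IsMonGenSet.wlen_mul_le (hS : IsMonGenSet S) (a b : G) :
    wlen S (a * b) ≤ wlen S a + wlen S b := by
  obtain ⟨l, hl, hn, rfl⟩ := hS.exists_list_length_eq_wlen a
  obtain ⟨m, hm, hk, rfl⟩ := hS.exists_list_length_eq_wlen b
  rw [← hn, ← hk, ← List.prod_append, ← List.length_append]
  refine wlen_le_length fun x hx => ?_
  rcases List.mem_append.1 hx with h | h
  exacts [hl x h, hm x h]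

theorem IsMonGenSet.wlen_pow_le (hS : IsMonGenSet S) (a : G) (n : ℕ) :
    wlen S (a ^ n) ≤ n * wlen S a := by
  induction n with
  | zero => simp [wlen_one]
  | succ n ih =>
    rw [pow_succ, add_mul, one_mul]
    exact (hS.wlen_mul_le _ _).trans (by gcongr)

theorem IsMonGenSet.wlen_zpow_le (hS : IsMonGenSet S) (a : G) (n : ℤ) :
    wlen S (a ^ n) ≤ n.natAbs * (wlen S a + wlen S a⁻¹) := by
  rcases Int.natAbs_eq n with h | h
  · rw [h, zpow_natCast, Int.natAbs_natCast]
    exact (hS.wlen_pow_le _ _).trans (by gcongr; omega)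
  · rw [h, zpow_neg, zpow_natCast, ← inv_pow, Int.natAbs_neg, Int.natAbs_natCast]
    exact (hS.wlen_pow_le _ _).trans (by gcongr; omega)

end WordLength

theorem exists_natAbs_coord_le {d : ℕ} {F : Type*}
    {S : Set (Multiplicative (Fin d → ℤ) × F)} (hS : S.Finite) :
    ∃ C : ℕ, ∀ s ∈ S, ∀ i, (s.1.toAdd i).natAbs ≤ C := by
  refine ⟨∑ s ∈ hS.toFinset, ∑ i, (s.1.toAdd i).natAbs, fun s hs i => ?_⟩
  calc (s.1.toAdd i).natAbs ≤ ∑ i, (s.1.toAdd i).natAbs :=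
        Finset.single_le_sum (f := fun i => (s.1.toAdd i).natAbs) (fun _ _ => Nat.zero_le _)
          (Finset.mem_univ i)
    _ ≤ _ := Finset.single_le_sum (f := fun s => ∑ i, (s.1.toAdd i).natAbs)
          (fun _ _ => Nat.zero_le _) (hS.mem_toFinset.2 hs)

section VirtuallyAbelian

variable {d : ℕ} {F : Type*} [Group F] {S : Set (Multiplicative (Fin d → ℤ) × F)}

theorem natAbs_coord_list_prod_le {C : ℕ} (hC : ∀ s ∈ S, ∀ i, (s.1.toAdd i).natAbs ≤ C)
    (l : List (Multiplicative (Fin d → ℤ) × F)) (hl : ∀ x ∈ l, x ∈ S) (i : Fin d) :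
    (l.prod.1.toAdd i).natAbs ≤ C * l.length := by
  induction l with
  | nil => simp
  | cons a l ih =>
    have h₁ := ih fun x hx => hl x (List.mem_cons_of_mem _ hx)
    have h₂ := hC a (hl a List.mem_cons_self) i
    rw [List.prod_cons, Prod.fst_mul, toAdd_mul, Pi.add_apply, List.length_cons, mul_add, mul_one]
    exact (Int.natAbs_add_le _ _).trans (by omega)

/-- The integer box of radius `n` in `ℤ^d`. -/
noncomputable def intBox (d n : ℕ) : Finset (Fin d → ℤ) := Fintype.piFinset fun _ => Finset.Icc (-n : ℤ) n

theorem mem_intBox {n : ℕ} {v : Fin d → ℤ} : v ∈ intBox d n ↔ ∀ i, (v i).natAbs ≤ n := by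
  simp only [intBox, Fintype.mem_piFinset, Finset.mem_Icc]
  exact forall_congr' fun i => by omega

theorem card_intBox (d n : ℕ) : (intBox d n).card = (2 * n + 1) ^ d := by
  rw [intBox, Fintype.card_piFinset_const, Int.card_Icc]
  congr 1
  omega

theorem ball_subset_intBox (hgen : IsMonGenSet S) {C : ℕ}
    (hC : ∀ s ∈ S, ∀ i, (s.1.toAdd i).natAbs ≤ C) (r : ℕ) :
    {g | wlen S g ≤ r} ⊆
      (Multiplicative.toAdd ⁻¹' (intBox d (C * r) : Set (Fin d → ℤ))) ×ˢ (Set.univ : Set F) := by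
  intro g hg
  obtain ⟨l, hl, hn, rfl⟩ := hgen.exists_list_length_eq_wlen g
  refine ⟨mem_intBox.2 fun i => ?_, trivial⟩
  refine (natAbs_coord_list_prod_le hC l hl i).trans ?_
  rw [hn]
  exact Nat.mul_le_mul_left _ hg

theorem finite_ball [Finite F] (hS : S.Finite) (hgen : IsMonGenSet S) (r : ℕ) :
    {g | wlen S g ≤ r}.Finite := by
  obtain ⟨C, hC⟩ := exists_natAbs_coord_le hS
  exact (((intBox d (C * r)).finite_toSet.preimage
    Multiplicative.toAdd.injective.injOn).prod Set.finite_univ).subset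
    (ball_subset_intBox hgen hC r)

theorem exists_growth_le [Finite F] (hS : S.Finite) (hgen : IsMonGenSet S) :
    ∃ C : ℕ, ∀ r, growth S r ≤ (2 * (C * r) + 1) ^ d * Nat.card F := by
  obtain ⟨C, hC⟩ := exists_natAbs_coord_le hS
  refine ⟨C, fun r => ?_⟩
  have hfin : (Multiplicative.toAdd ⁻¹' (intBox d (C * r) : Set (Fin d → ℤ))).Finite :=
    (intBox d (C * r)).finite_toSet.preimage Multiplicative.toAdd.injective.injOn
  refine (Set.ncard_le_ncard (ball_subset_intBox hgen hC r) (hfin.prod Set.finite_univ)).trans ?_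
  rw [Set.ncard_prod, Set.ncard_univ, Set.ncard_preimage_of_injective_subset_range
    Multiplicative.toAdd.injective (by simp), Set.ncard_coe_finset, card_intBox]

theorem exists_le_growth [Finite F] (hS : S.Finite) (hgen : IsMonGenSet S) :
    ∃ K : ℕ, ∀ r, (2 * r + 1) ^ d ≤ growth S (K * r) := by
  let e (i : Fin d) : Multiplicative (Fin d → ℤ) × F :=
    (Multiplicative.ofAdd (Pi.single i 1), 1)
  let f (v : Fin d → ℤ) : ℕ := wlen S (Multiplicative.ofAdd v, (1 : F))
  have hadd (u v : Fin d → ℤ) : f (u + v) ≤ f u + f v := by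
    have := hgen.wlen_mul_le (Multiplicative.ofAdd u, (1 : F)) (Multiplicative.ofAdd v, 1)
    rwa [Prod.mk_mul_mk, mul_one, ← ofAdd_add] at this
  have hsingle (i : Fin d) (z : ℤ) :
      f (Pi.single i z) ≤ z.natAbs * (wlen S (e i) + wlen S (e i)⁻¹) := by
    have heq : e i ^ z = (Multiplicative.ofAdd (Pi.single i z), 1) := by
      simp [e, ← ofAdd_zsmul, ← Pi.single_smul]
    have := hgen.wlen_zpow_le (e i) z
    rwa [heq] at this
  refine ⟨∑ i, (wlen S (e i) + wlen S (e i)⁻¹), fun r => ?_⟩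
  rw [← card_intBox, ← Set.ncard_coe_finset]
  refine Set.ncard_le_ncard_of_injOn
    (fun v => (Multiplicative.ofAdd v, (1 : F))) (fun v hv => ?_) (fun u _ v _ huv => ?_)
    (finite_ball hS hgen _)
  · have hv' := mem_intBox.1 (Finset.mem_coe.1 hv)
    change f v ≤ _
    calc f v = f (∑ i, Pi.single i (v i)) := by rw [Finset.univ_sum_single]
      _ ≤ ∑ i, f (Pi.single i (v i)) :=
        Finset.le_sum_of_subadditive f (wlen_one S).le hadd _ _
      _ ≤ ∑ i, (wlen S (e i) + wlen S (e i)⁻¹) * r := Finset.sum_le_sum fun i _ => by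
        rw [mul_comm]
        exact (hsingle i (v i)).trans (Nat.mul_le_mul_right _ (hv' i))
      _ = _ := (Finset.sum_mul _ _ _).symm
  · exact Multiplicative.ofAdd.injective (congrArg Prod.fst huv)

theorem rank_le_of_growth_eq {d' : ℕ} {F' : Type*} [Group F'] [Finite F] [Finite F']
    {S' : Set (Multiplicative (Fin d' → ℤ) × F')}
    (hS : S.Finite) (hS' : S'.Finite) (hgen : IsMonGenSet S) (hgen' : IsMonGenSet S')
    (h : growth S = growth S') : d ≤ d' := by
  obtain ⟨K, hK⟩ := exists_le_growth hS hgen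
  obtain ⟨C, hC⟩ := exists_growth_le hS' hgen'
  by_contra! hlt
  obtain ⟨k, rfl⟩ := Nat.exists_eq_add_of_lt hlt
  set M := (C * K + 1) ^ d' * Nat.card F'
  have hle : (2 * M + 1) ^ d' * (2 * M + 1) ^ (k + 1) ≤ (2 * M + 1) ^ d' * M :=
    calc (2 * M + 1) ^ d' * (2 * M + 1) ^ (k + 1) = (2 * M + 1) ^ (d' + k + 1) := by ring
      _ ≤ growth S' (K * M) := h ▸ hK M
      _ ≤ (2 * (C * (K * M)) + 1) ^ d' * Nat.card F' := hC _
      _ ≤ ((2 * M + 1) * (C * K + 1)) ^ d' * Nat.card F' := by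
        gcongr
        nlinarith [Nat.zero_le (C * K)]
      _ = (2 * M + 1) ^ d' * M := by rw [mul_pow, mul_assoc]
  have hM := Nat.le_of_mul_le_mul_left hle (by positivity)
  have := Nat.le_self_pow k.add_one_ne_zero (2 * M + 1)
  omega

end VirtuallyAbelian

/-- Necessary condition: equal growth functions of `ℤ^d × F` and `ℤ^{d'} × F'`
(with respect to finite monoid generating sets) force `d = d'`. -/
theorem rank_eq_of_growth_eq (d d' : ℕ) (F F' : Type*) [Group F] [Group F'] [Finite F] [Finite F']
    (S : Set (Multiplicative (Fin d → ℤ) × F)) (S' : Set (Multiplicative (Fin d' → ℤ) × F'))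
    (hS : S.Finite) (hS' : S'.Finite) (hgen : IsMonGenSet S) (hgen' : IsMonGenSet S')
    (h : growth S = growth S') : d = d' :=
  le_antisymm (rank_le_of_growth_eq hS hS' hgen hgen' h)
    (rank_le_of_growth_eq hS' hS hgen' hgen h.symm)
end

section
/- Let d ∈ ℕ with d > 0, and let F₁ and F₂ be finite groups such that |F₁| ≡ |F₂| (mod 2). Then there exist finite symmetric generating sets S₁ of G₁ := ℤ^d × F₁ and S₂ of G₂ := ℤ^d × F₂ such that σ_{G₁,S₁} = σ_{G₂,S₂}, and consequently β_{G₁,S₁} = β_{G₂,S₂}. -/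
open scoped Pointwise

section WordLength

variable {G : Type*} [Group G] {S : Set G}

theorem wlen_le_iff_mem_pow (h1 : (1 : G) ∈ S) (hgen : ∀ g, ∃ n : ℕ, g ∈ S ^ n) (g : G) (r : ℕ) :
    wlen S g ≤ r ↔ g ∈ S ^ r := by
  have key : ∀ n : ℕ, (∃ l : List G, (∀ x ∈ l, x ∈ S) ∧ l.length = n ∧ l.prod = g) ↔
      g ∈ S ^ n := by
    intro n
    induction n generalizing g with
    | zero =>
      constructor
      · rintro ⟨l, -, hl, rfl⟩
        simp [List.length_eq_zero_iff.mp hl]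
      · intro h
        exact ⟨[], by simp, rfl, by simpa [eq_comm] using h⟩
    | succ n ih =>
      rw [pow_succ', Set.mem_mul]
      constructor
      · rintro ⟨_ | ⟨a, l⟩, hS, hl, rfl⟩
        · simp at hl
        · exact ⟨a, hS a (by simp), l.prod,
            (ih _).mp ⟨l, fun x hx => hS x (by simp [hx]), by simpa using hl, rfl⟩, by simp⟩
      · rintro ⟨a, ha, b, hb, rfl⟩
        obtain ⟨l, hS, hl, rfl⟩ := (ih b).mpr hb
        refine ⟨a :: l, ?_, by simp [hl], by simp⟩
        intro x hx
        rcases List.mem_cons.mp hx with rfl | hx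
        · exact ha
        · exact hS x hx
  have hset : {n | ∃ l : List G, (∀ x ∈ l, x ∈ S) ∧ l.length = n ∧ l.prod = g} =
      {n | g ∈ S ^ n} := Set.ext key
  unfold wlen
  rw [hset]
  constructor
  · intro h
    exact Set.pow_right_monotone h1 h (Nat.sInf_mem (hgen g))
  · intro h
    exact Nat.sInf_le h

theorem growth_eq_ncard_pow (h1 : (1 : G) ∈ S) (hgen : ∀ g, ∃ n : ℕ, g ∈ S ^ n) (r : ℕ) :
    growth S r = (S ^ r).ncard := by
  unfold growth
  congr 1
  ext g
  exact wlen_le_iff_mem_pow h1 hgen g r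

theorem isMonGenSet_of_forall_mem_pow (hgen : ∀ g, ∃ n : ℕ, g ∈ S ^ n) : IsMonGenSet S := by
  rw [IsMonGenSet, eq_top_iff]
  rintro g -
  obtain ⟨n, hn⟩ := hgen g
  have : ∀ (n : ℕ) (g : G), g ∈ S ^ n → g ∈ Submonoid.closure S := by
    intro n
    induction n with
    | zero =>
      intro g hg
      have : g = 1 := by simpa using hg
      exact this ▸ one_mem _
    | succ n ih =>
      intro g hg
      rw [pow_succ] at hg
      obtain ⟨a, ha, b, hb, rfl⟩ := hg
      exact mul_mem (ih a ha) (Submonoid.subset_closure hb)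
  exact this n g hn

theorem forall_mem_pow_of_isMonGenSet (h1 : (1 : G) ∈ S) (hS : IsMonGenSet S) (g : G) :
    ∃ n : ℕ, g ∈ S ^ n := by
  have hg : g ∈ Submonoid.closure S := by rw [hS]; trivial
  induction hg using Submonoid.closure_induction with
  | mem x hx => exact ⟨1, by simpa using hx⟩
  | one => exact ⟨1, by simpa using h1⟩
  | mul x y _ _ hx hy =>
    obtain ⟨a, ha⟩ := hx
    obtain ⟨b, hb⟩ := hy
    exact ⟨a + b, pow_add S a b ▸ Set.mul_mem_mul ha hb⟩

theorem sph_zero : sph S 0 = growth S 0 := by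
  simp [sph, growth]

theorem sph_succ (hfin : S.Finite) (h1 : (1 : G) ∈ S) (hgen : ∀ g, ∃ n : ℕ, g ∈ S ^ n) (r : ℕ) :
    sph S (r + 1) = growth S (r + 1) - growth S r := by
  have hfinr : {g : G | wlen S g ≤ r}.Finite := by
    have : {g : G | wlen S g ≤ r} = S ^ r := Set.ext fun g => wlen_le_iff_mem_pow h1 hgen g r
    rw [this]
    clear this
    induction r with
    | zero => simp [← Set.singleton_one]
    | succ r ih => rw [pow_succ]; exact Set.Finite.mul ih hfin
  unfold sph growth
  rw [← Set.ncard_sdiff ?_ hfinr]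
  · congr 1
    ext g
    simp only [Set.mem_ofPred_eq, Set.mem_sdiff]
    omega
  · intro g hg
    simp only [Set.mem_ofPred_eq] at hg ⊢
    omega

theorem exists_finite_symm_isMonGenSet (G : Type*) [Group G] [Group.FG G] :
    ∃ K : Set G, K.Finite ∧ IsSymmSet K ∧ (1 : G) ∈ K ∧ IsMonGenSet K := by
  obtain ⟨S, hS, hfin⟩ := Group.fg_iff.mp (inferInstance : Group.FG G)
  refine ⟨insert 1 (S ∪ S⁻¹), (hfin.union hfin.inv).insert 1, ?_, by simp, ?_⟩
  · rintro s (rfl | hs | hs)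
    · simp
    · right; right; simpa using hs
    · right; left; exact hs
  · rw [IsMonGenSet, Submonoid.closure_insert_one, ← Subgroup.closure_toSubmonoid, hS]
    rfl

end WordLength

theorem Set.prod_pow_eq {M N : Type*} [Monoid M] [Monoid N] (s : Set M) (t : Set N) (n : ℕ) :
    (s ×ˢ t) ^ n = (s ^ n) ×ˢ (t ^ n) := by
  induction n with
  | zero => ext ⟨a, b⟩; simp [Prod.ext_iff]
  | succ n ih => rw [pow_succ, pow_succ, pow_succ, ih, Set.prod_mul_prod_comm]

section Layer

variable {F : Type*} [Group F]

/-- A finite part of `ℤ × F`: every fibre is the interval `[-(R - t), R - t]`, except that the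
fibre over `1` is the longer interval `[-(R - t + s), R - t + s]` together with `±R`. -/
def layer (F : Type*) [Group F] (t s R : ℤ) : Set (Multiplicative ℤ × F) :=
  {p | |p.1.toAdd| ≤ R - t ∨ p.2 = 1 ∧ (|p.1.toAdd| ≤ R - t + s ∨ |p.1.toAdd| = R)}

theorem mk_mem_layer {t s R n : ℤ} {f : F} : (Multiplicative.ofAdd n, f) ∈ layer F t s R ↔
    |n| ≤ R - t ∨ f = 1 ∧ (|n| ≤ R - t + s ∨ |n| = R) := Iff.rfl

theorem layer_mul {t s N R : ℤ} (hs : 0 ≤ s) (hst : 2 * s ≤ t) (ht : 1 ≤ t) (hN : 2 * t ≤ N)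
    (hR : N ≤ R) : layer F t s R * layer F t s N = layer F t s (R + N) := by
  apply Set.Subset.antisymm
  · rintro _ ⟨⟨a, f⟩, ha, ⟨b, g⟩, hb, rfl⟩
    induction a with | ofAdd a => ?_
    induction b with | ofAdd b => ?_
    rw [mk_mem_layer, Int.abs_eq_natAbs] at ha hb
    show (Multiplicative.ofAdd (a + b), f * g) ∈ layer F t s (R + N)
    rw [mk_mem_layer, Int.abs_eq_natAbs]
    rcases ha with ha | ⟨rfl, ha⟩ <;> rcases hb with hb | ⟨rfl, hb⟩
    · left; omega
    · left; omega
    · left; omega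
    · rw [mul_one]
      simp only [true_and]
      omega
  · rintro ⟨a, f⟩ ha
    induction a with | ofAdd a => ?_
    rw [mk_mem_layer, Int.abs_eq_natAbs] at ha
    have split : ∀ b : ℤ, (Multiplicative.ofAdd (a - b), f) ∈ layer F t s R →
        (Multiplicative.ofAdd b, (1 : F)) ∈ layer F t s N →
        (Multiplicative.ofAdd a, f) ∈ layer F t s R * layer F t s N := by
      intro b h1 h2
      refine ⟨_, h1, _, h2, ?_⟩
      simp
    simp only [mk_mem_layer, Int.abs_eq_natAbs] at split
    rcases lt_or_ge (a.natAbs : ℤ) t with h | h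
    · exact split 0 (by left; omega) (by left; omega)
    rcases le_total 0 a with h0 | h0
    · refine split N ?_ (by right; exact ⟨trivial, by omega⟩)
      rcases ha with ha | ⟨rfl, ha⟩
      · left; omega
      · right; exact ⟨rfl, by omega⟩
    · refine split (-N) ?_ (by right; exact ⟨trivial, by omega⟩)
      rcases ha with ha | ⟨rfl, ha⟩
      · left; omega
      · right; exact ⟨rfl, by omega⟩

theorem layer_pow_succ {t s N : ℤ} (hs : 0 ≤ s) (hst : 2 * s ≤ t) (ht : 1 ≤ t) (hN : 2 * t ≤ N)
    (r : ℕ) : layer F t s N ^ (r + 1) = layer F t s ((r + 1) * N) := by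
  induction r with
  | zero => simp
  | succ r ih =>
    rw [pow_succ, ih, layer_mul hs hst ht hN (by nlinarith [Int.natCast_nonneg r])]
    congr 1
    push_cast
    ring

theorem ncard_layer [Finite F] {t s R : ℤ} (hs : 0 ≤ s) (hst : 2 * s ≤ t) (ht : 1 ≤ t)
    (hR : 2 * t ≤ R) :
    ((layer F t s R).ncard : ℤ) = Nat.card F * (2 * R - 2 * t + 1) + 2 * s + 2 := by
  classical
  have := Fintype.ofFinite F
  let A : Finset (ℤ × F) := Finset.Icc (-(R - t)) (R - t) ×ˢ Finset.univ
  let B : Finset (ℤ × F) := Finset.Ioc (R - t) (R - t + s) ×ˢ {1}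
  let C : Finset (ℤ × F) := Finset.Ico (-(R - t + s)) (-(R - t)) ×ˢ {1}
  let D : Finset (ℤ × F) := {R, -R} ×ˢ {1}
  have hcard : (layer F t s R).ncard = (A ∪ B ∪ C ∪ D).card := by
    rw [← Set.ncard_coe_finset, ← Set.ncard_image_of_injective (layer F t s R)
      ((Multiplicative.toAdd (α := ℤ)).prodCongr (Equiv.refl F)).injective]
    congr 1
    ext ⟨n, f⟩
    have : (n, f) ∈ (Multiplicative.toAdd.prodCongr (Equiv.refl F)) '' layer F t s R ↔
        (Multiplicative.ofAdd n, f) ∈ layer F t s R := by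
      constructor
      · rintro ⟨⟨a, g⟩, h, he⟩
        cases he
        exact h
      · intro h
        exact ⟨_, h, rfl⟩
    rw [this, mk_mem_layer]
    simp only [A, B, C, D, Finset.coe_union, Set.mem_union, Finset.mem_coe, Finset.mem_product,
      Finset.mem_Icc, Finset.mem_Ioc, Finset.mem_Ico, Finset.mem_univ, and_true,
      Finset.mem_singleton, Finset.mem_insert]
    by_cases hf : f = 1
    · simp only [hf, true_and, and_true]
      grind
    · simp only [hf, false_and, and_false, or_false]
      grind
  rw [hcard, Finset.card_union_of_disjoint, Finset.card_union_of_disjoint,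
    Finset.card_union_of_disjoint]
  · have hRR : R ≠ -R := by omega
    simp only [A, B, C, D, Finset.card_product, Int.card_Icc, Int.card_Ioc, Int.card_Ico,
      Finset.card_univ, Finset.card_singleton, Finset.card_pair hRR, Nat.card_eq_fintype_card]
    push_cast
    rw [Int.toNat_of_nonneg (by omega), Int.toNat_of_nonneg (by omega),
      Int.toNat_of_nonneg (by omega)]
    ring
  all_goals
    rw [Finset.disjoint_left]
    rintro ⟨n, f⟩
    simp only [A, B, C, D, Finset.mem_union, Finset.mem_product,
      Finset.mem_Icc, Finset.mem_Ioc, Finset.mem_Ico, Finset.mem_univ, and_true,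
      Finset.mem_singleton, Finset.mem_insert]
    grind

theorem one_mem_layer {t s R : ℤ} (h : t ≤ R) : (1 : Multiplicative ℤ × F) ∈ layer F t s R := by
  left
  simpa using h

theorem isSymmSet_layer (t s R : ℤ) : IsSymmSet (layer F t s R) := by
  rintro ⟨a, f⟩ h
  induction a with | ofAdd a => ?_
  rw [mk_mem_layer] at h
  show (Multiplicative.ofAdd (-a), f⁻¹) ∈ layer F t s R
  rw [mk_mem_layer, abs_neg, inv_eq_one]
  exact h

theorem forall_mem_layer_pow {t s N : ℤ} (hs : 0 ≤ s) (hst : 2 * s ≤ t) (ht : 1 ≤ t)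
    (hN : 2 * t ≤ N) (g : Multiplicative ℤ × F) : ∃ n : ℕ, g ∈ layer F t s N ^ n := by
  obtain ⟨a, f⟩ := g
  induction a with | ofAdd a => ?_
  refine ⟨a.natAbs + 1, ?_⟩
  rw [layer_pow_succ hs hst ht hN, mk_mem_layer]
  left
  rw [Int.natCast_natAbs]
  nlinarith [abs_nonneg a]

end Layer

/-- Splitting off the first coordinate of `ℤ^(k+1)` and attaching it to the second factor. -/
def splitFirst (k : ℕ) (F : Type*) [Group F] :
    Multiplicative (Fin k → ℤ) × (Multiplicative ℤ × F) ≃* Multiplicative (Fin (k + 1) → ℤ) × F where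
  toFun p := (Multiplicative.ofAdd (Fin.cons p.2.1.toAdd p.1.toAdd), p.2.2)
  invFun p := (Multiplicative.ofAdd (Fin.tail p.1.toAdd),
    (Multiplicative.ofAdd (p.1.toAdd 0), p.2))
  left_inv p := by simp
  right_inv p := by simp
  map_mul' p q := by
    refine Prod.ext ?_ rfl
    apply Multiplicative.toAdd.injective
    funext i
    refine Fin.cases ?_ (fun j => ?_) i <;> simp

theorem exists_generating_set_of_layer {k : ℕ} {K : Set (Multiplicative (Fin k → ℤ))}
    (hK : K.Finite) (hKsymm : IsSymmSet K) (hK1 : 1 ∈ K) (hKgen : IsMonGenSet K)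
    (F : Type*) [Group F] [Finite F] {t s N : ℤ} (hs : 0 ≤ s) (hst : 2 * s ≤ t) (ht : 1 ≤ t)
    (hN : 2 * t ≤ N) :
    ∃ S : Set (Multiplicative (Fin (k + 1) → ℤ) × F), S.Finite ∧ IsSymmSet S ∧ 1 ∈ S ∧
      (∀ g, ∃ n : ℕ, g ∈ S ^ n) ∧
      ∀ r : ℕ, growth S r = (K ^ r).ncard * (layer F t s N ^ r).ncard := by
  have hpow (r : ℕ) : (splitFirst k F '' (K ×ˢ layer F t s N)) ^ r =
      splitFirst k F '' ((K ^ r) ×ˢ (layer F t s N ^ r)) := by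
    rw [← Set.prod_pow_eq, Set.image_pow]
  have hlfin : (layer F t s N).Finite := by
    apply Set.finite_of_ncard_ne_zero
    have := ncard_layer (F := F) hs hst ht hN
    have : 0 ≤ (Nat.card F : ℤ) * (2 * N - 2 * t + 1) := by
      apply mul_nonneg <;> omega
    omega
  have hl1 : (1 : Multiplicative ℤ × F) ∈ layer F t s N := one_mem_layer (by omega)
  have h1 : (1 : Multiplicative (Fin (k + 1) → ℤ) × F) ∈
      splitFirst k F '' (K ×ˢ layer F t s N) := ⟨1, ⟨hK1, hl1⟩, map_one _⟩
  have hgen : ∀ g, ∃ n : ℕ, g ∈ (splitFirst k F '' (K ×ˢ layer F t s N)) ^ n := by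
    intro g
    obtain ⟨⟨x, y⟩, rfl⟩ := (splitFirst k F).surjective g
    obtain ⟨a, ha⟩ := forall_mem_pow_of_isMonGenSet hK1 hKgen x
    obtain ⟨b, hb⟩ := forall_mem_layer_pow hs hst ht hN y
    refine ⟨max a b, ?_⟩
    rw [hpow]
    exact Set.mem_image_of_mem _ ⟨Set.pow_right_monotone hK1 (le_max_left a b) ha,
      Set.pow_right_monotone hl1 (le_max_right a b) hb⟩
  refine ⟨splitFirst k F '' (K ×ˢ layer F t s N), (hK.prod hlfin).image _, ?_, h1, hgen, ?_⟩
  · rintro _ ⟨⟨x, y⟩, ⟨hx, hy⟩, rfl⟩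
    exact ⟨(x, y)⁻¹, ⟨hKsymm x hx, isSymmSet_layer t s N y hy⟩, map_inv _ _⟩
  · intro r
    rw [growth_eq_ncard_pow h1 hgen, hpow,
      Set.ncard_image_of_injective _ (splitFirst k F).injective, Set.ncard_prod]

theorem ncard_layer_pow_eq {F₁ F₂ : Type*} [Group F₁] [Group F₂] [Finite F₁] [Finite F₂]
    {t₁ s₁ N₁ t₂ s₂ N₂ : ℤ} (hs₁ : 0 ≤ s₁) (hst₁ : 2 * s₁ ≤ t₁) (ht₁ : 1 ≤ t₁)
    (hN₁ : 2 * t₁ ≤ N₁) (hs₂ : 0 ≤ s₂) (hst₂ : 2 * s₂ ≤ t₂) (ht₂ : 1 ≤ t₂) (hN₂ : 2 * t₂ ≤ N₂)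
    (hN : Nat.card F₁ * N₁ = Nat.card F₂ * N₂)
    (hend : Nat.card F₁ * (1 - 2 * t₁) + 2 * s₁ = Nat.card F₂ * (1 - 2 * t₂) + 2 * s₂) (r : ℕ) :
    (layer F₁ t₁ s₁ N₁ ^ r).ncard = (layer F₂ t₂ s₂ N₂ ^ r).ncard := by
  cases r with
  | zero => simp [← Set.singleton_one]
  | succ r =>
    rw [layer_pow_succ hs₁ hst₁ ht₁ hN₁, layer_pow_succ hs₂ hst₂ ht₂ hN₂, ← Nat.cast_inj (R := ℤ),
      ncard_layer hs₁ hst₁ ht₁ (by nlinarith [Int.natCast_nonneg r]),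
      ncard_layer hs₂ hst₂ ht₂ (by nlinarith [Int.natCast_nonneg r])]
    linear_combination 2 * ((r : ℤ) + 1) * hN + hend

/-- Witnesses in the symmetric case: if `|F₁| ≡ |F₂| mod 2`, then `ℤ^d × F₁` and
`ℤ^d × F₂` admit finite symmetric generating sets with equal spherical growth
functions, and thus equal growth functions. -/
theorem exists_symmetric_witnesses (d : ℕ) (hd : 0 < d)
    (F₁ F₂ : Type*) [Group F₁] [Group F₂] [Finite F₁] [Finite F₂]
    (hpar : Nat.card F₁ % 2 = Nat.card F₂ % 2) :
    ∃ (S₁ : Set (Multiplicative (Fin d → ℤ) × F₁)) (S₂ : Set (Multiplicative (Fin d → ℤ) × F₂)),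
      S₁.Finite ∧ S₂.Finite ∧ IsSymmSet S₁ ∧ IsSymmSet S₂ ∧ IsMonGenSet S₁ ∧ IsMonGenSet S₂ ∧
      sph S₁ = sph S₂ ∧ growth S₁ = growth S₂ := by
  obtain ⟨k, rfl⟩ : ∃ k, d = k + 1 := ⟨d - 1, by omega⟩
  obtain ⟨K, hK, hKsymm, hK1, hKgen⟩ :=
    exists_finite_symm_isMonGenSet (Multiplicative (Fin k → ℤ))
  have hm₁ : 0 < Nat.card F₁ := Nat.card_pos
  have hm₂ : 0 < Nat.card F₂ := Nat.card_pos
  -- In each pair, one of the two truncated differences vanishes.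
  obtain ⟨s₁, hs₁⟩ : ∃ s : ℕ, 2 * s = Nat.card F₂ - Nat.card F₁ :=
    ⟨(Nat.card F₂ - Nat.card F₁) / 2, by omega⟩
  obtain ⟨s₂, hs₂⟩ : ∃ s : ℕ, 2 * s = Nat.card F₁ - Nat.card F₂ :=
    ⟨(Nat.card F₁ - Nat.card F₂) / 2, by omega⟩
  obtain ⟨S₁, hfin₁, hsymm₁, hone₁, hgen₁, hgrowth₁⟩ := exists_generating_set_of_layer hK hKsymm
    hK1 hKgen F₁ (t := Nat.card F₂) (s := s₁) (N := 2 * Nat.card F₂) (by omega) (by omega)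
    (by omega) le_rfl
  obtain ⟨S₂, hfin₂, hsymm₂, hone₂, hgen₂, hgrowth₂⟩ := exists_generating_set_of_layer hK hKsymm
    hK1 hKgen F₂ (t := Nat.card F₁) (s := s₂) (N := 2 * Nat.card F₁) (by omega) (by omega)
    (by omega) le_rfl
  have hends : (Nat.card F₁ : ℤ) + 2 * s₁ = Nat.card F₂ + 2 * s₂ := by omega
  have hgrowth : growth S₁ = growth S₂ := by
    funext r
    rw [hgrowth₁, hgrowth₂]
    congr 1
    apply ncard_layer_pow_eq (by omega) (by omega) (by omega) le_rfl (by omega) (by omega)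
      (by omega) le_rfl
    · ring
    · linear_combination hends
  refine ⟨S₁, S₂, hfin₁, hfin₂, hsymm₁, hsymm₂, isMonGenSet_of_forall_mem_pow hgen₁,
    isMonGenSet_of_forall_mem_pow hgen₂, ?_, hgrowth⟩
  funext r
  cases r with
  | zero => rw [sph_zero, sph_zero, hgrowth]
  | succ r => rw [sph_succ hfin₁ hone₁ hgen₁, sph_succ hfin₂ hone₂ hgen₂, hgrowth]
end
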